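/- Let G be a simple graph on n vertices with matching number β, and let q(G) denote the largest eigenvalue of its signless Laplacian matrix Q(G) = D(G) + A(G). If n = (5β + 3)/2, then q(G) ≤ 4β, with equality if and only if G is isomorphic to the join K_β ∨ K̄_{n−β} or to the disjoint union K_{2β+1} ∪ K̄_{n−2β−1}. -/

import Mathlib

open scoped Classical

/-- The adjacency matrix of a graph, over ℝ. -/
noncomputable def adjMat {V : Type*} [Fintype V] (G : SimpleGraph V) : Matrix V V ℝ :=
  fun i j => if G.Adj i j then 1 else 0

/-- The diagonal matrix of vertex degrees, over ℝ. -/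
noncomputable def degMat {V : Type*} [Fintype V] (G : SimpleGraph V) : Matrix V V ℝ :=
  fun i j => if i = j then ((G.neighborSet i).ncard : ℝ) else 0

/-- The largest (real) eigenvalue of a matrix. -/
noncomputable def specRad {V : Type*} [Fintype V] (M : Matrix V V ℝ) : ℝ :=
  sSup {t : ℝ | ∃ v : V → ℝ, v ≠ 0 ∧ M.mulVec v = t • v}

/-- The α-spectral radius: the largest eigenvalue of A_α(G) = α·D(G) + A(G). -/
noncomputable def alphaRadius {V : Type*} [Fintype V] (α : ℝ) (G : SimpleGraph V) : ℝ :=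
  specRad (α • degMat G + adjMat G)

/-- The matching number of a graph. -/
noncomputable def matchingNumber {V : Type*} [Fintype V] (G : SimpleGraph V) : ℕ :=
  sSup {m : ℕ | ∃ M : G.Subgraph, M.IsMatching ∧ M.edgeSet.ncard = m}

/-- The join of two graphs. -/
def graphJoin {A B : Type*} (G : SimpleGraph A) (H : SimpleGraph B) : SimpleGraph (A ⊕ B) :=
  SimpleGraph.fromRel (fun x y => match x, y with
    | Sum.inl a, Sum.inl b => G.Adj a b
    | Sum.inr a, Sum.inr b => H.Adj a b
    | _, _ => True)

/-- The disjoint union of two graphs. -/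
def graphSum {A B : Type*} (G : SimpleGraph A) (H : SimpleGraph B) : SimpleGraph (A ⊕ B) :=
  SimpleGraph.fromRel (fun x y => match x, y with
    | Sum.inl a, Sum.inl b => G.Adj a b
    | Sum.inr a, Sum.inr b => H.Adj a b
    | _, _ => False)

/-- The number of odd components of G − S. -/
noncomputable def oddComponentsOutside {V : Type*} [Fintype V] (G : SimpleGraph V) (S : Set V) : ℕ :=
  Set.ncard {c : (G.induce Sᶜ).ConnectedComponent | Odd c.supp.ncard}

/-- The disjoint union of cliques K_{f 0} ∪ ⋯ ∪ K_{f (q-1)}. -/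
def cliquesUnion (q : ℕ) (f : Fin q → ℕ) : SimpleGraph (Σ i : Fin q, Fin (f i)) :=
  SimpleGraph.fromRel (fun x y => x.1 = y.1)


/-- A matching covers twice as many vertices as it has edges. -/
theorem ncard_verts_of_isMatching {V : Type*} [Fintype V] {G : SimpleGraph V} {M : G.Subgraph}
    (hM : M.IsMatching) : M.verts.ncard = 2 * M.edgeSet.ncard := by
  have h := M.spanningCoe.sum_degrees_eq_twice_card_edges
  rw [← SimpleGraph.Subgraph.edgeSet_spanningCoe, ← SimpleGraph.coe_edgeFinset,
    Set.ncard_coe_finset, ← h, Set.ncard_eq_toFinset_card', Finset.card_eq_sum_ones,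
    ← Finset.sum_subset (Finset.subset_univ M.verts.toFinset)]
  · refine Finset.sum_congr rfl fun v hv => ?_
    rw [SimpleGraph.Subgraph.degree_spanningCoe]
    exact ((SimpleGraph.Subgraph.isMatching_iff_forall_degree.1 hM) v (by simpa using hv)).symm
  · intro v _ hv
    rw [SimpleGraph.Subgraph.degree_spanningCoe]
    exact SimpleGraph.Subgraph.degree_of_notMem_verts (by simpa using hv)

theorem ncard_edgeSet_le_matchingNumber {V : Type*} [Fintype V] {G : SimpleGraph V}
    {M : G.Subgraph} (hM : M.IsMatching) : M.edgeSet.ncard ≤ matchingNumber G := by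
  refine le_csSup ⟨(Set.univ : Set (Sym2 V)).ncard, ?_⟩ ⟨M, hM, rfl⟩
  rintro _ ⟨M', -, rfl⟩
  exact Set.ncard_le_ncard (Set.subset_univ _) Set.finite_univ

theorem graphJoin_adj_inl_inl {A B : Type*} (G : SimpleGraph A) (H : SimpleGraph B) (a b : A) :
    (graphJoin G H).Adj (.inl a) (.inl b) ↔ G.Adj a b := by
  simp only [graphJoin, SimpleGraph.fromRel_adj, G.adj_comm b a, or_self, ne_eq, Sum.inl.injEq]
  exact ⟨And.right, fun h => ⟨h.ne, h⟩⟩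

theorem graphJoin_adj_inr_inr {A B : Type*} (G : SimpleGraph A) (H : SimpleGraph B) (a b : B) :
    (graphJoin G H).Adj (.inr a) (.inr b) ↔ H.Adj a b := by
  simp only [graphJoin, SimpleGraph.fromRel_adj, H.adj_comm b a, or_self, ne_eq, Sum.inr.injEq]
  exact ⟨And.right, fun h => ⟨h.ne, h⟩⟩

theorem graphJoin_adj_inl_inr {A B : Type*} (G : SimpleGraph A) (H : SimpleGraph B) (a : A)
    (b : B) : (graphJoin G H).Adj (.inl a) (.inr b) := by
  simp [graphJoin]

theorem graphSum_adj_inl_inl {A B : Type*} (G : SimpleGraph A) (H : SimpleGraph B) (a b : A) :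
    (graphSum G H).Adj (.inl a) (.inl b) ↔ G.Adj a b := by
  simp only [graphSum, SimpleGraph.fromRel_adj, G.adj_comm b a, or_self, ne_eq, Sum.inl.injEq]
  exact ⟨And.right, fun h => ⟨h.ne, h⟩⟩

theorem graphSum_adj_inr_inr {A B : Type*} (G : SimpleGraph A) (H : SimpleGraph B) (a b : B) :
    (graphSum G H).Adj (.inr a) (.inr b) ↔ H.Adj a b := by
  simp only [graphSum, SimpleGraph.fromRel_adj, H.adj_comm b a, or_self, ne_eq, Sum.inr.injEq]
  exact ⟨And.right, fun h => ⟨h.ne, h⟩⟩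

theorem not_graphSum_adj_inl_inr {A B : Type*} (G : SimpleGraph A) (H : SimpleGraph B) (a : A)
    (b : B) : ¬ (graphSum G H).Adj (.inl a) (.inr b) := by
  simp [graphSum]

/-- A perfect matching of the join with a complete graph on `d` vertices restricts to a matching
that misses at most `d` vertices. -/
theorem card_le_of_isPerfectMatching_graphJoin {V : Type*} [Fintype V] {G : SimpleGraph V} {d : ℕ}
    {M : (graphJoin G (⊤ : SimpleGraph (Fin d))).Subgraph} (hM : M.IsPerfectMatching) :
    Fintype.card V ≤ 2 * matchingNumber G + d := by
  let N : G.Subgraph :=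
    { verts := {v | ∃ u, M.Adj (.inl v) (.inl u)}
      Adj := fun u v => M.Adj (.inl u) (.inl v)
      adj_sub := fun {u v} h => (graphJoin_adj_inl_inl G ⊤ u v).1 h.adj_sub
      edge_vert := fun {u v} h => ⟨v, h⟩
      symm := ⟨fun u v h => h.symm⟩ }
  have hN : N.IsMatching := by
    rintro v ⟨u, hu⟩
    exact ⟨u, hu, fun w hw => Sum.inl_injective (hM.1.eq_of_adj_left hw hu)⟩
  have h1 := ncard_verts_of_isMatching hN
  have h2 := ncard_edgeSet_le_matchingNumber hN
  have h3 : (N.vertsᶜ).ncard ≤ d := by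
    choose p hp _ using fun a : Fin d => hM.1 (hM.2 (.inr a))
    have hsub : Sum.inl '' N.vertsᶜ ⊆ Set.range p := by
      rintro _ ⟨v, hv, rfl⟩
      obtain ⟨w | a, hw, -⟩ := hM.1 (hM.2 (.inl v))
      · exact (hv ⟨w, hw⟩).elim
      · exact ⟨a, hM.1.eq_of_adj_left (hp a) hw.symm⟩
    calc (N.vertsᶜ).ncard = (Sum.inl '' N.vertsᶜ : Set (V ⊕ Fin d)).ncard :=
          (Set.ncard_image_of_injective _ Sum.inl_injective).symm
      _ ≤ (Set.range p).ncard := Set.ncard_le_ncard hsub (Set.toFinite _)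
      _ ≤ d := by
        rw [← Set.image_univ]
        exact (Set.ncard_image_le Set.finite_univ).trans (by simp [Set.ncard_univ])
  have h4 := Set.ncard_add_ncard_compl N.verts
  rw [Nat.card_eq_fintype_card] at h4
  lia

/-- If more than `2ν + d` vertices are present (with the right parity), Tutte's theorem for the
join with a complete graph on `d` vertices yields a barrier containing that complete graph. -/
theorem exists_barrier_graphJoin {V : Type*} [Fintype V] (G : SimpleGraph V) {d : ℕ}
    (hcard : Fintype.card V = 2 * matchingNumber G + d + 2) :
    ∃ T : Set (V ⊕ Fin d), (∀ a, Sum.inr a ∈ T) ∧ T.ncard + 2 ≤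
      ((⊤ : (graphJoin G (⊤ : SimpleGraph (Fin d))).Subgraph).deleteVerts
        T).coe.oddComponents.ncard := by
  have hno : ¬ ∃ M : (graphJoin G (⊤ : SimpleGraph (Fin d))).Subgraph, M.IsPerfectMatching := by
    rintro ⟨M, hM⟩
    have := card_le_of_isPerfectMatching_graphJoin hM
    lia
  rw [SimpleGraph.tutte] at hno
  push Not at hno
  obtain ⟨T, hT⟩ := hno
  rw [SimpleGraph.IsTutteViolator] at hT
  set K := ((⊤ : (graphJoin G (⊤ : SimpleGraph (Fin d))).Subgraph).deleteVerts T).coe with hK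
  have hpar := SimpleGraph.odd_ncard_oddComponents K
  have hverts : Nat.card ((⊤ : (graphJoin G (⊤ : SimpleGraph (Fin d))).Subgraph).deleteVerts
      T).verts + T.ncard = Fintype.card V + d := by
    have h := Set.ncard_add_ncard_compl T
    rw [Nat.card_eq_fintype_card, Fintype.card_sum, Fintype.card_fin] at h
    rw [Nat.card_coe_set_eq, SimpleGraph.Subgraph.deleteVerts_verts,
      SimpleGraph.Subgraph.verts_top, ← Set.compl_eq_univ_sdiff]
    lia
  have h2 : T.ncard + 2 ≤ K.oddComponents.ncard := by
    by_contra! hlt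
    have heq : K.oddComponents.ncard = T.ncard + 1 := by lia
    rw [heq] at hpar
    rcases Nat.even_or_odd T.ncard with h | h
    · have := hpar.1 h.add_one
      grind
    · have : ¬ Odd (T.ncard + 1) := by grind
      have := fun h' => this (hpar.2 h')
      grind
  refine ⟨T, fun a => ?_, h2⟩
  by_contra ha
  have hle : K.oddComponents.ncard ≤ 1 := by
    refine (Set.ncard_le_one_iff (Set.toFinite _)).2 fun {c c'} _ _ => ?_
    have hall : ∀ c : K.ConnectedComponent,
        c = K.connectedComponentMk ⟨Sum.inr a, by simpa using ha⟩ := by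
      intro c
      induction c using SimpleGraph.ConnectedComponent.ind with | _ x => ?_
      rw [SimpleGraph.ConnectedComponent.eq]
      by_cases hx : x = ⟨Sum.inr a, by simpa using ha⟩
      · rw [hx]
      · refine SimpleGraph.Adj.reachable ?_
        obtain ⟨x, hxT⟩ := x
        simp only [SimpleGraph.Subgraph.verts_top, SimpleGraph.Subgraph.deleteVerts_verts,
          Set.mem_sdiff, Set.mem_univ, true_and] at hxT
        simp only [hK, SimpleGraph.Subgraph.coe_adj, SimpleGraph.Subgraph.deleteVerts_adj,
          SimpleGraph.Subgraph.verts_top, Set.mem_univ, hxT, ha, not_false_eq_true, true_and,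
          SimpleGraph.Subgraph.top_adj]
        rcases x with v | b
        · exact graphJoin_adj_inl_inr _ _ _ _
        · rw [graphJoin_adj_inr_inr, SimpleGraph.top_adj]
          rintro rfl
          exact hx rfl
    rw [hall c, hall c']
  lia

/-- If `Σ kᵢ` exceeds the number of odd `kᵢ` by at most `M`, then each `kᵢ` is at most `M + 1`
and `Σ kᵢ (kᵢ - 1)` is at most `(M + 1) M`. -/
theorem sum_mul_pred_le_of_sum_le {ι : Type*} [Fintype ι] (k : ι → ℕ) {M : ℕ}
    (h : ∑ i, k i ≤ (Finset.univ.filter fun i => Odd (k i)).card + M) :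
    (∀ i, k i ≤ M + 1) ∧ ∑ i, k i * (k i - 1) ≤ (M + 1) * M := by
  have hg : ∑ i, (k i - if Odd (k i) then 1 else 0) ≤ M := by
    have h1 : ∑ i, (k i - if Odd (k i) then 1 else 0) + ∑ i, (if Odd (k i) then 1 else 0)
        = ∑ i, k i := by
      rw [← Finset.sum_add_distrib]
      refine Finset.sum_congr rfl fun i _ => ?_
      split_ifs with ho
      · have := ho.pos
        lia
      · rfl
    rw [Finset.card_filter] at h
    lia
  have hk : ∀ i, k i ≤ M + 1 := by
    intro i
    have := Finset.single_le_sum (f := fun i => k i - if Odd (k i) then 1 else 0)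
      (fun _ _ => Nat.zero_le _) (Finset.mem_univ i)
    split_ifs at this <;> lia
  refine ⟨hk, ?_⟩
  calc ∑ i, k i * (k i - 1) ≤ ∑ i, (M + 1) * (k i - if Odd (k i) then 1 else 0) := by
        refine Finset.sum_le_sum fun i _ => Nat.mul_le_mul (hk i) ?_
        split_ifs <;> lia
    _ = (M + 1) * ∑ i, (k i - if Odd (k i) then 1 else 0) := by rw [Finset.mul_sum]
    _ ≤ (M + 1) * M := Nat.mul_le_mul_left _ hg

/-- A Berge-type decomposition: outside a set `S` of at most `ν` vertices, the vertex set splits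
into unions of components `P v` that are small. -/
theorem exists_small_clusters {V : Type*} [Fintype V] (G : SimpleGraph V) {ν d : ℕ}
    (hν : matchingNumber G = ν) (hcard : Fintype.card V = 2 * ν + d + 2) :
    ∃ (S : Finset V) (P : V → Finset V), S.card ≤ ν ∧
      (∀ v ∉ S, v ∈ P v) ∧
      (∀ v ∉ S, ∀ u ∉ S, G.Adj v u → u ∈ P v) ∧
      (∀ v, ∀ u ∈ P v, P u = P v) ∧
      (∀ v, (P v).card ≤ 2 * (ν - S.card) + 1) ∧
      ∑ v ∈ Sᶜ, ((P v).card - 1) ≤ (2 * (ν - S.card) + 1) * (2 * (ν - S.card)) := by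
  obtain ⟨T, hinr, hT⟩ := exists_barrier_graphJoin G (d := d) (by rw [hν]; exact hcard)
  set H := ((⊤ : (graphJoin G (⊤ : SimpleGraph (Fin d))).Subgraph).deleteVerts T)
  set K := H.coe
  set S : Finset V := Finset.univ.filter fun v => Sum.inl v ∈ T
  have hmem : ∀ v, v ∉ S ↔ Sum.inl v ∈ H.verts := by simp [S, H]
  have hTcard : T.ncard = S.card + d := by
    have hTeq : T = Sum.inl '' (S : Set V) ∪ Set.range Sum.inr := by
      ext (v | a) <;> simp [S, hinr]
    rw [hTeq, Set.ncard_union_eq, Set.ncard_image_of_injective _ Sum.inl_injective,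
      Set.ncard_coe_finset, ← Set.image_univ, Set.ncard_image_of_injective _ Sum.inr_injective,
      Set.ncard_univ, Nat.card_eq_fintype_card, Fintype.card_fin]
    rw [Set.disjoint_left]
    rintro _ ⟨v, -, rfl⟩ ⟨a, ha⟩
    cases ha
  let e : {v // v ∈ Sᶜ} ≃ H.verts := Equiv.ofBijective
    (fun v => ⟨Sum.inl v.1, (hmem v.1).1 (Finset.mem_compl.1 v.2)⟩) <| by
      constructor
      · rintro ⟨u, hu⟩ ⟨v, hv⟩ huv
        simpa using huv
      · rintro ⟨v | a, hx⟩
        · exact ⟨⟨v, Finset.mem_compl.2 ((hmem v).2 hx)⟩, rfl⟩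
        · simp [H, hinr] at hx
  let comp : {v // v ∈ Sᶜ} → K.ConnectedComponent := fun v => K.connectedComponentMk (e v)
  let k : K.ConnectedComponent → ℕ := fun c => (Finset.univ.filter fun v => comp v = c).card
  have hk : ∀ c, k c = c.supp.ncard := by
    intro c
    have : c.supp = e '' {v | comp v = c} := by
      ext x
      obtain ⟨v, rfl⟩ := e.surjective x
      simp [comp]
    rw [this, Set.ncard_image_of_injective _ e.injective, Set.ncard_eq_toFinset_card']
    simp [k]
  have hsum : ∑ c, k c = Fintype.card V - S.card := by
    have h := Finset.card_eq_sum_card_fiberwise (f := comp) (s := Finset.univ)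
      (t := Finset.univ) fun _ _ => Finset.mem_univ _
    rw [Finset.card_univ, Fintype.card_coe, Finset.card_compl] at h
    exact h.symm
  have hodd : (Finset.univ.filter fun c => Odd (k c)).card = K.oddComponents.ncard := by
    rw [SimpleGraph.oddComponents, Set.ncard_eq_toFinset_card']
    congr 1
    ext c
    simp [hk]
  have hoddle : (Finset.univ.filter fun c => Odd (k c)).card ≤ ∑ c, k c := by
    rw [Finset.card_filter]
    refine Finset.sum_le_sum fun c _ => ?_
    split_ifs with ho
    · exact ho.pos
    · exact Nat.zero_le _
  have hScard : S.card ≤ Fintype.card V := Finset.card_le_univ S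
  have hSν : S.card ≤ ν := by lia
  obtain ⟨hb1, hb2⟩ := sum_mul_pred_le_of_sum_le k (M := 2 * (ν - S.card)) (by lia)
  let P : V → Finset V := fun v => if h : v ∈ Sᶜ then
    (Finset.univ.filter fun u => comp u = comp ⟨v, h⟩).map (Function.Embedding.subtype _) else ∅
  have hP : ∀ v (h : v ∈ Sᶜ), P v = (Finset.univ.filter fun u => comp u = comp ⟨v, h⟩).map
      (Function.Embedding.subtype _) := fun v h => by simp only [P, dif_pos h]
  have hP' : ∀ v, v ∉ Sᶜ → P v = ∅ := fun v h => by simp only [P, dif_neg h]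
  have hPcard : ∀ v (h : v ∈ Sᶜ), (P v).card = k (comp ⟨v, h⟩) := fun v h => by
    rw [hP v h, Finset.card_map]
  refine ⟨S, P, hSν, ?_, ?_, ?_, ?_, ?_⟩
  · intro v hv
    rw [← Finset.mem_compl] at hv
    rw [hP v hv]
    simpa using hv
  · intro v hv u hu huv
    rw [← Finset.mem_compl] at hv hu
    rw [hP v hv, Finset.mem_map]
    refine ⟨⟨u, hu⟩, ?_, rfl⟩
    rw [Finset.mem_filter]
    refine ⟨Finset.mem_univ _, ?_⟩
    simp only [comp, SimpleGraph.ConnectedComponent.eq]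
    refine SimpleGraph.Adj.reachable ?_
    have hu' := (hmem u).1 (Finset.mem_compl.1 hu)
    have hv' := (hmem v).1 (Finset.mem_compl.1 hv)
    have huv' := (graphJoin_adj_inl_inl G (⊤ : SimpleGraph (Fin d)) u v).2 huv.symm
    exact SimpleGraph.Subgraph.deleteVerts_adj.2
      ⟨Set.mem_univ _, hu'.2, Set.mem_univ _, hv'.2, huv'⟩
  · intro v u hu
    by_cases hv : v ∈ Sᶜ
    · rw [hP v hv, Finset.mem_map] at hu
      obtain ⟨w, hw, rfl⟩ := hu
      rw [Finset.mem_filter] at hw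
      rw [hP v hv, Function.Embedding.subtype_apply, hP w w.2, ← hw.2]
    · simp [hP' v hv] at hu
  · intro v
    by_cases hv : v ∈ Sᶜ
    · rw [hPcard v hv]
      exact hb1 _
    · simp [hP' v hv]
  · refine le_trans (le_of_eq ?_) hb2
    rw [← Finset.sum_coe_sort Sᶜ fun v => (P v).card - 1]
    rw [← Finset.sum_fiberwise Finset.univ comp]
    refine Finset.sum_congr rfl fun c _ => ?_
    rw [Finset.sum_congr rfl (g := fun _ => k c - 1), Finset.sum_const, smul_eq_mul]
    rintro ⟨v, hv⟩ hvc
    rw [Finset.mem_filter] at hvc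
    rw [hPcard v hv, hvc.2]

theorem signlessLaplacian_mulVec {V : Type*} [Fintype V] (G : SimpleGraph V) (v : V → ℝ) (i : V) :
    (degMat G + adjMat G).mulVec v i = ∑ j, if G.Adj i j then v i + v j else 0 := by
  have h1 : (degMat G).mulVec v i = ∑ j, if G.Adj i j then v i else 0 := by
    simp only [Matrix.mulVec, dotProduct, degMat, ite_mul, zero_mul, Finset.sum_ite_eq,
      Finset.mem_univ, if_true]
    rw [← Finset.sum_filter, Finset.sum_const, nsmul_eq_mul, Set.ncard_eq_toFinset_card']
    congr 3
    ext j
    simp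
  rw [Matrix.add_mulVec, Pi.add_apply, h1, Matrix.mulVec, dotProduct, ← Finset.sum_add_distrib]
  refine Finset.sum_congr rfl fun j _ => ?_
  simp only [adjMat]
  split_ifs <;> simp

/-- A Collatz–Wielandt bound: a positive vector `w` with `Q w ≤ lam w` bounds every eigenvalue of
the signless Laplacian, and if `lam` is attained then `Q w = lam w` holds on a nonempty set of
vertices closed under adjacency. -/
theorem eigenvalue_le_of_supersolution {V : Type*} [Fintype V] (G : SimpleGraph V) {w : V → ℝ}
    {lam : ℝ} (hw : ∀ i, 0 < w i)
    (hrow : ∀ i, (∑ j, if G.Adj i j then w i + w j else 0) ≤ lam * w i)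
    {t : ℝ} {v : V → ℝ} (hv : v ≠ 0) (hQ : (degMat G + adjMat G).mulVec v = t • v) :
    t ≤ lam ∧ (t = lam → ∃ X : Set V, X.Nonempty ∧ ∀ i ∈ X,
      (∑ j, if G.Adj i j then w i + w j else 0) = lam * w i ∧ ∀ j, G.Adj i j → j ∈ X) := by
  obtain ⟨i₀, hi₀⟩ := Function.ne_iff.1 hv
  have : Nonempty V := ⟨i₀⟩
  obtain ⟨m, hm⟩ := Finite.exists_max fun i => |v i| / w i
  set M := |v m| / w m with hMdef
  have hM : 0 < M := lt_of_lt_of_le (div_pos (abs_pos.2 hi₀) (hw i₀)) (hm i₀)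
  have hle : ∀ j, |v j| ≤ M * w j := fun j => (div_le_iff₀ (hw j)).1 (hm j)
  have habs : ∀ i, t * |v i| ≤ ∑ j, if G.Adj i j then |v i| + |v j| else 0 := by
    intro i
    have h1 := congrFun hQ i
    rw [signlessLaplacian_mulVec, Pi.smul_apply, smul_eq_mul] at h1
    calc t * |v i| ≤ |t| * |v i| := mul_le_mul_of_nonneg_right (le_abs_self t) (abs_nonneg _)
      _ = |∑ j, if G.Adj i j then v i + v j else 0| := by rw [h1, abs_mul]
      _ ≤ ∑ j, |if G.Adj i j then v i + v j else 0| := Finset.abs_sum_le_sum_abs _ _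
      _ ≤ _ := by
        refine Finset.sum_le_sum fun j _ => ?_
        split_ifs
        · exact abs_add_le _ _
        · simp
  have hterm : ∀ i j, (if G.Adj i j then |v i| + |v j| else 0) ≤
      M * (if G.Adj i j then w i + w j else 0) := by
    intro i j
    split_ifs
    · rw [mul_add]
      exact add_le_add (hle i) (hle j)
    · simp
  have hsum : ∀ i, (∑ j, if G.Adj i j then |v i| + |v j| else 0) ≤
      M * ∑ j, (if G.Adj i j then w i + w j else 0) := by
    intro i
    rw [Finset.mul_sum]
    exact Finset.sum_le_sum fun j _ => hterm i j
  have hmeq : |v m| = M * w m := (div_mul_cancel₀ _ (hw m).ne').symm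
  constructor
  · have h1 := (habs m).trans ((hsum m).trans (mul_le_mul_of_nonneg_left (hrow m) hM.le))
    rw [hmeq] at h1
    have h2 : 0 < M * w m := mul_pos hM (hw m)
    nlinarith
  · rintro rfl
    refine ⟨{i | |v i| = M * w i}, ⟨m, hmeq⟩, fun i (hi : |v i| = M * w i) => ?_⟩
    have h1 := habs i
    have h2 := hsum i
    have h3 := mul_le_mul_of_nonneg_left (hrow i) hM.le
    have h0 : t * |v i| = M * (t * w i) := by rw [hi]; ring
    have heq : (∑ j, if G.Adj i j then w i + w j else 0) = t * w i :=
      mul_left_cancel₀ hM.ne' (by linarith)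
    refine ⟨heq, fun j hj => ?_⟩
    have h4 : (∑ j, if G.Adj i j then |v i| + |v j| else 0) =
        ∑ j, M * (if G.Adj i j then w i + w j else 0) := by
      rw [← Finset.mul_sum]
      linarith
    have h5 := (Finset.sum_eq_sum_iff_of_le fun j _ => hterm i j).1 h4 j (Finset.mem_univ j)
    rw [if_pos hj, if_pos hj, hi] at h5
    show |v j| = M * w j
    linarith

/-- The case of `exists_small_clusters` with an empty barrier. -/
theorem eigenvalue_le_of_clusters {V : Type*} [Fintype V] (G : SimpleGraph V) {β : ℕ}
    {P : V → Finset V} (hmem : ∀ v, v ∈ P v) (hadj : ∀ v u, G.Adj v u → u ∈ P v)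
    (hP : ∀ v, ∀ u ∈ P v, P u = P v) (hcard : ∀ v, (P v).card ≤ 2 * β + 1)
    (hsum : ∑ v, ((P v).card - 1) ≤ (2 * β + 1) * (2 * β))
    {t : ℝ} {v : V → ℝ} (hv : v ≠ 0) (hQ : (degMat G + adjMat G).mulVec v = t • v) :
    t ≤ 4 * β ∧ (t = 4 * β → ∃ U : Finset V, U.card = 2 * β + 1 ∧
      ∀ i j, G.Adj i j ↔ i ≠ j ∧ i ∈ U ∧ j ∈ U) := by
  have hrowsum : ∀ i, (∑ j, if G.Adj i j then (1 : ℝ) + 1 else 0) =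
      2 * ((Finset.univ.filter fun j => G.Adj i j).card : ℝ) := by
    intro i
    rw [← Finset.sum_filter, Finset.sum_const, nsmul_eq_mul]
    ring
  have hsub : ∀ i, (Finset.univ.filter fun j => G.Adj i j) ⊆ (P i).erase i := by
    intro i j hj
    rw [Finset.mem_filter] at hj
    exact Finset.mem_erase.2 ⟨hj.2.ne', hadj i j hj.2⟩
  have hcardE : ∀ i, ((P i).erase i).card ≤ 2 * β := fun i => by
    have := hcard i
    rw [Finset.card_erase_of_mem (hmem i)]
    lia
  obtain ⟨h1, h2⟩ := eigenvalue_le_of_supersolution G (w := fun _ => 1) (lam := 4 * β)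
    (fun _ => one_pos) (fun i => by
      rw [hrowsum, mul_one]
      have : ((Finset.univ.filter fun j => G.Adj i j).card : ℝ) ≤ 2 * β := by
        exact_mod_cast (Finset.card_le_card (hsub i)).trans (hcardE i)
      linarith) hv hQ
  refine ⟨h1, fun ht => ?_⟩
  obtain ⟨X, ⟨x, hx⟩, hX⟩ := h2 ht
  have hfull : ∀ i ∈ X, (P i).card = 2 * β + 1 ∧ ∀ j, G.Adj i j ↔ j ≠ i ∧ j ∈ P i := by
    intro i hi
    have h3 := (hX i hi).1
    rw [hrowsum, mul_one] at h3
    have h4 : (Finset.univ.filter fun j => G.Adj i j).card = 2 * β := by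
      have : ((Finset.univ.filter fun j => G.Adj i j).card : ℝ) = 2 * β := by linarith
      exact_mod_cast this
    have h5 := Finset.eq_of_subset_of_card_le (hsub i) (h4.symm ▸ hcardE i)
    constructor
    · have h6 := Finset.card_erase_add_one (hmem i)
      rw [← h5, h4] at h6
      exact h6.symm
    · intro j
      rw [← Finset.mem_erase, ← h5]
      simp
  have hXP : ∀ j ∈ P x, j ∈ X := by
    intro j hj
    by_cases hjx : j = x
    · exact hjx ▸ hx
    · exact (hX x hx).2 j (((hfull x hx).2 j).2 ⟨hjx, hj⟩)
  refine ⟨P x, (hfull x hx).1, fun i j => ?_⟩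
  by_cases hi : i ∈ P x
  · rw [(hfull i (hXP i hi)).2, hP x i hi]
    tauto
  · have h7 : ∑ v ∈ P x, ((P v).card - 1) = (2 * β + 1) * (2 * β) := by
      rw [Finset.sum_congr rfl (g := fun _ => 2 * β), Finset.sum_const, (hfull x hx).1,
        smul_eq_mul]
      intro v hv
      rw [hP x v hv, (hfull x hx).1, Nat.add_sub_cancel]
    have h8 := Finset.sum_le_sum_of_subset (f := fun v => (P v).card - 1)
      (Finset.subset_univ (insert i (P x)))
    rw [Finset.sum_insert hi, h7] at h8
    have h9 : (P i).card ≤ 1 := by lia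
    have h10 := Finset.card_le_one.1 h9
    simp only [hi, false_and, and_false, iff_false]
    exact fun h => h.ne (h10 i (hmem i) j (hadj i j h))

/-- The case of `exists_small_clusters` with a nonempty barrier. -/
theorem eigenvalue_le_of_barrier {V : Type*} [Fintype V] (G : SimpleGraph V) {β : ℕ}
    {S : Finset V} {P : V → Finset V} (hn : 2 * (Fintype.card V : ℝ) = 5 * β + 3)
    (hS : S.Nonempty) (hSβ : S.card ≤ β) (hmem : ∀ v ∉ S, v ∈ P v)
    (hadj : ∀ v ∉ S, ∀ u ∉ S, G.Adj v u → u ∈ P v) (hP : ∀ v, ∀ u ∈ P v, P u = P v)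
    (hcard : ∀ v, (P v).card ≤ 2 * (β - S.card) + 1)
    (hsum : ∑ v ∈ Sᶜ, ((P v).card - 1) ≤ (2 * (β - S.card) + 1) * (2 * (β - S.card)))
    {t : ℝ} {v : V → ℝ} (hv : v ≠ 0) (hQ : (degMat G + adjMat G).mulVec v = t • v) :
    t ≤ 4 * β ∧ (t = 4 * β → S.card = β ∧
      ∀ i j, G.Adj i j ↔ i ≠ j ∧ (i ∈ S ∨ j ∈ S)) := by
  have hs1 : (1 : ℝ) ≤ S.card := by exact_mod_cast hS.card_pos
  have hsβ : (S.card : ℝ) ≤ β := by exact_mod_cast hSβ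
  set s : ℝ := (S.card : ℝ)
  set b : ℝ := 3 * (4 * β - s) with hb
  have hbpos : 0 < b := by linarith
  set w : V → ℝ := fun i => if i ∈ S then b else 3 * s + 2 * ((P i).card - 1) with hwdef
  have hwS : ∀ i ∈ S, w i = b := fun i hi => by simp only [hwdef, if_pos hi]
  have hwS' : ∀ i ∉ S, w i = 3 * s + 2 * ((P i).card - 1) := fun i hi => by
    simp only [hwdef, if_neg hi]
  have hc1 : ∀ i ∉ S, (1 : ℝ) ≤ (P i).card := fun i hi => by
    exact_mod_cast Finset.card_pos.2 ⟨i, hmem i hi⟩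
  have hc2 : ∀ i, ((P i).card : ℝ) ≤ 2 * (β - s) + 1 := fun i => by
    have := hcard i
    have h : ((P i).card : ℝ) ≤ ((2 * (β - S.card) + 1 : ℕ) : ℝ) := by exact_mod_cast this
    rwa [Nat.cast_add, Nat.cast_mul, Nat.cast_sub hSβ, Nat.cast_ofNat, Nat.cast_one] at h
  have hwpos : ∀ i, 0 < w i := by
    intro i
    by_cases hi : i ∈ S
    · rwa [hwS i hi]
    · rw [hwS' i hi]
      linarith [hc1 i hi]
  have hwsum : ∑ j, w j ≤ s * b + 3 * s * (Fintype.card V - s) +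
      2 * ((2 * (β - s) + 1) * (2 * (β - s))) := by
    rw [← Finset.sum_add_sum_compl S, Finset.sum_congr rfl hwS, Finset.sum_const, nsmul_eq_mul]
    have h1 : ∑ j ∈ Sᶜ, w j = 3 * s * (Fintype.card V - s) +
        2 * ((∑ j ∈ Sᶜ, ((P j).card - 1) : ℕ) : ℝ) := by
      rw [Finset.sum_congr rfl (g := fun j => 3 * s + 2 * (((P j).card - 1 : ℕ) : ℝ)),
        Finset.sum_add_distrib, Finset.sum_const, nsmul_eq_mul, ← Finset.mul_sum,
        Finset.card_compl, Nat.cast_sub (Finset.card_le_univ S), Nat.cast_sum]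
      · ring
      · intro j hj
        have hj' := Finset.mem_compl.1 hj
        rw [hwS' j hj', Nat.cast_sub (Finset.card_pos.2 ⟨j, hmem j hj'⟩), Nat.cast_one]
    have h2 : ((∑ j ∈ Sᶜ, ((P j).card - 1) : ℕ) : ℝ) ≤ (2 * (β - s) + 1) * (2 * (β - s)) := by
      have h : ((∑ j ∈ Sᶜ, ((P j).card - 1) : ℕ) : ℝ) ≤
        ((((2 * (β - S.card) + 1) * (2 * (β - S.card)) : ℕ)) : ℝ) := by exact_mod_cast hsum
      rwa [Nat.cast_mul, Nat.cast_add, Nat.cast_mul, Nat.cast_sub hSβ, Nat.cast_ofNat,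
        Nat.cast_one] at h
    rw [h1]
    linarith
  let g : V → V → ℝ := fun i j =>
    if i ∈ S then (if j = i then 0 else w i + w j)
    else (if j ∈ S then w i + b else 0) + (if j ∈ (P i).erase i then 2 * w i else 0)
  have hg : ∀ i j, (if G.Adj i j then w i + w j else 0) ≤ g i j := by
    intro i j
    have hi' := (hwpos i).le
    have hj' := (hwpos j).le
    simp only [g]
    by_cases hi : i ∈ S
    · rw [if_pos hi]
      by_cases hji : j = i
      · rw [if_neg (by rw [hji]; exact G.loopless.irrefl i), if_pos hji]
      · rw [if_neg hji]
        split_ifs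
        · exact le_rfl
        · linarith
    · rw [if_neg hi]
      have h3 : 0 ≤ if j ∈ (P i).erase i then 2 * w i else 0 := by split_ifs <;> linarith
      by_cases hj : j ∈ S
      · rw [if_pos hj, hwS j hj]
        split_ifs at h3 ⊢ <;> linarith
      · rw [if_neg hj, zero_add]
        by_cases hij : G.Adj i j
        · have hjP := hadj i hi j hj hij
          rw [if_pos hij, if_pos (Finset.mem_erase.2 ⟨hij.ne', hjP⟩), hwS' j hj, hwS' i hi,
            hP i j hjP]
          linarith
        · rwa [if_neg hij]
  have hgS : ∀ i ∈ S, (∑ j, g i j) + 2 * (β - s) * (5 * β + s + 1) ≤ 4 * β * w i := by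
    intro i hi
    have h4 : ∑ j, g i j = Fintype.card V * w i + ∑ j, w j - 2 * w i := by
      have : ∀ j, g i j = w i + w j - if j = i then 2 * w i else 0 := by
        intro j
        simp only [g, if_pos hi]
        split_ifs with h
        · rw [h]; ring
        · ring
      simp only [this]
      rw [Finset.sum_sub_distrib, Finset.sum_add_distrib, Finset.sum_ite_eq']
      simp
    rw [h4, hwS i hi]
    have hn' : (Fintype.card V : ℝ) = (5 * β + 3) / 2 := by linarith
    rw [hn'] at hwsum ⊢
    rw [hb] at hwsum ⊢
    nlinarith
  have hgS' : ∀ i ∉ S, ∑ j, g i j ≤ 4 * β * w i := by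
    intro i hi
    have h5 : ∑ j, g i j = s * (w i + b) + (((P i).card : ℝ) - 1) * (2 * w i) := by
      simp only [g, if_neg hi]
      rw [Finset.sum_add_distrib, Finset.sum_ite_mem, Finset.sum_ite_mem, Finset.univ_inter,
        Finset.univ_inter, Finset.sum_const, Finset.sum_const, nsmul_eq_mul, nsmul_eq_mul,
        Finset.card_erase_of_mem (hmem i hi),
        Nat.cast_sub (Finset.card_pos.2 ⟨i, hmem i hi⟩), Nat.cast_one]
    rw [h5, hwS' i hi, hb]
    nlinarith [mul_nonneg (sub_nonneg.2 (hc1 i hi)) (sub_nonneg.2 (hc2 i))]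
  have hnonneg : 0 ≤ 2 * (β - s) * (5 * β + s + 1) :=
    mul_nonneg (by linarith) (by linarith)
  have hgall : ∀ i, ∑ j, g i j ≤ 4 * β * w i := fun i => by
    by_cases hi : i ∈ S
    · linarith [hgS i hi]
    · exact hgS' i hi
  have hle : ∀ i, (∑ j, if G.Adj i j then w i + w j else 0) ≤ ∑ j, g i j :=
    fun i => Finset.sum_le_sum fun j _ => hg i j
  obtain ⟨h6, h7⟩ := eigenvalue_le_of_supersolution G hwpos
    (fun i => (hle i).trans (hgall i)) hv hQ
  refine ⟨h6, fun ht => ?_⟩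
  obtain ⟨X, ⟨x, hx⟩, hX⟩ := h7 ht
  have htight : ∀ i ∈ X, ∀ j, (if G.Adj i j then w i + w j else 0) = g i j := by
    intro i hi j
    refine (Finset.sum_eq_sum_iff_of_le fun j _ => hg i j).1 ?_ j (Finset.mem_univ j)
    exact le_antisymm (hle i) ((hgall i).trans_eq (hX i hi).1.symm)
  have hposadj : ∀ i ∈ X, ∀ j, 0 < g i j → G.Adj i j := by
    intro i hi j hij
    by_contra hna
    rw [← htight i hi j, if_neg hna] at hij
    exact lt_irrefl _ hij
  have hSX : ∃ i ∈ S, i ∈ X := by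
    by_cases hxS : x ∈ S
    · exact ⟨x, hxS, hx⟩
    · obtain ⟨y, hy⟩ := hS
      refine ⟨y, hy, (hX x hx).2 y (hposadj x hx y ?_)⟩
      simp only [g, if_neg hxS, if_pos hy]
      have := hwpos x
      split_ifs <;> linarith
  have hSadj : ∀ i ∈ S, i ∈ X → ∀ j, j ≠ i → G.Adj i j := by
    intro i hi hiX j hji
    refine hposadj i hiX j ?_
    simp only [g, if_pos hi, if_neg hji]
    linarith [hwpos i, hwpos j]
  obtain ⟨y, hyS, hyX⟩ := hSX
  have hall : ∀ j, j ∈ X := fun j => by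
    by_cases hj : j = y
    · exact hj ▸ hyX
    · exact (hX y hyX).2 j (hSadj y hyS hyX j hj)
  have hsβ' : s = β := by
    have h8 := hgS y hyS
    have h9 := hle y
    rw [(hX y hyX).1] at h9
    have h10 : (β - s) * (2 * (5 * β + s + 1)) ≤ 0 := by linarith
    have h11 : (0 : ℝ) < 2 * (5 * β + s + 1) := by linarith
    nlinarith
  have hSeq : S.card = β := Nat.cast_injective (R := ℝ) hsβ'
  refine ⟨hSeq, fun i j => ⟨fun h => ⟨h.ne, ?_⟩, ?_⟩⟩
  · by_contra! hij
    have h12 := hcard i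
    rw [hSeq, Nat.sub_self, mul_zero, zero_add] at h12
    exact h.ne (Finset.card_le_one.1 h12 i (hmem i hij.1) j (hadj i hij.1 j hij.2 h))
  · rintro ⟨hne, hi | hj⟩
    · exact hSadj i hi (hall i) j hne.symm
    · exact (hSadj j hj (hall j) i hne).symm

theorem exists_equiv_fin_sum {V : Type*} [Fintype V] (S : Finset V) {a b : ℕ} (ha : S.card = a)
    (hb : Fintype.card V - a = b) :
    ∃ e : Fin a ⊕ Fin b ≃ V, (∀ x, e (.inl x) ∈ S) ∧ ∀ y, e (.inr y) ∉ S := by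
  have h1 : Fintype.card {v // v ∈ S} = a := by simpa using ha
  have h2 : Fintype.card {v // v ∉ S} = b := by
    rw [Fintype.card_subtype_compl, h1, hb]
  exact ⟨(Equiv.sumCongr (Fintype.equivFinOfCardEq h1).symm
    (Fintype.equivFinOfCardEq h2).symm).trans (Equiv.sumCompl fun v => v ∈ S),
    fun x => ((Fintype.equivFinOfCardEq h1).symm x).2,
    fun y => ((Fintype.equivFinOfCardEq h2).symm y).2⟩

theorem nonempty_iso_graphJoin {V : Type*} [Fintype V] {G : SimpleGraph V} {S : Finset V}
    {a b : ℕ} (ha : S.card = a) (hb : Fintype.card V - a = b)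
    (hG : ∀ i j, G.Adj i j ↔ i ≠ j ∧ (i ∈ S ∨ j ∈ S)) :
    Nonempty (G ≃g graphJoin (⊤ : SimpleGraph (Fin a)) (⊥ : SimpleGraph (Fin b))) := by
  obtain ⟨e, he1, he2⟩ := exists_equiv_fin_sum S ha hb
  refine ⟨SimpleGraph.Iso.symm ⟨e, ?_⟩⟩
  rintro (x | x) (y | y)
  · simp [hG, he1, graphJoin_adj_inl_inl]
  · simp [hG, he1, graphJoin_adj_inl_inr]
  · simp [hG, he1, (graphJoin_adj_inl_inr _ _ _ _).symm]
  · simp [hG, he2, graphJoin_adj_inr_inr]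

theorem nonempty_iso_graphSum {V : Type*} [Fintype V] {G : SimpleGraph V} {S : Finset V}
    {a b : ℕ} (ha : S.card = a) (hb : Fintype.card V - a = b)
    (hG : ∀ i j, G.Adj i j ↔ i ≠ j ∧ i ∈ S ∧ j ∈ S) :
    Nonempty (G ≃g graphSum (⊤ : SimpleGraph (Fin a)) (⊥ : SimpleGraph (Fin b))) := by
  obtain ⟨e, he1, he2⟩ := exists_equiv_fin_sum S ha hb
  refine ⟨SimpleGraph.Iso.symm ⟨e, ?_⟩⟩
  rintro (x | x) (y | y)
  · simp [hG, he1, graphSum_adj_inl_inl]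
  · simp [hG, he2, not_graphSum_adj_inl_inr]
  · simp [hG, he2, SimpleGraph.adj_comm _ (Sum.inr x), not_graphSum_adj_inl_inr]
  · simp [hG, he2, graphSum_adj_inr_inr]

theorem mulVec_comp_iso {V W : Type*} [Fintype V] [Fintype W] {G : SimpleGraph V}
    {H : SimpleGraph W} (φ : G ≃g H) {v : W → ℝ} {t : ℝ}
    (hv : ∀ i, (∑ j, if H.Adj i j then v i + v j else 0) = t * v i) :
    (degMat G + adjMat G).mulVec (v ∘ φ) = t • (v ∘ φ) := by
  ext i
  rw [signlessLaplacian_mulVec, Pi.smul_apply, smul_eq_mul, Function.comp_apply, ← hv (φ i),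
    ← φ.toEquiv.sum_comp]
  exact Finset.sum_congr rfl fun j _ => by simp [SimpleGraph.Iso.map_adj_iff]

theorem sum_ite_ne_eq {m : ℕ} (a : Fin m) (c : ℝ) :
    (∑ b : Fin m, if a ≠ b then c else 0) = (m - 1) * c := by
  have : ∀ b, (if a ≠ b then c else 0) = c - if a = b then c else 0 := fun b => by
    by_cases h : a = b <;> simp [h]
  simp only [this]
  rw [Finset.sum_sub_distrib, Finset.sum_ite_eq]
  simp
  ring

theorem exists_eigenvector_of_iso_graphJoin {V : Type*} [Fintype V] {G : SimpleGraph V} {β m : ℕ}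
    (hβ : 0 < β) (hm : 2 * (m : ℝ) = 3 * β + 3)
    (φ : G ≃g graphJoin (⊤ : SimpleGraph (Fin β)) (⊥ : SimpleGraph (Fin m))) :
    ∃ v : V → ℝ, v ≠ 0 ∧ (degMat G + adjMat G).mulVec v = (4 * β : ℝ) • v := by
  refine ⟨Sum.elim (fun _ => 3) (fun _ => 1) ∘ φ, fun h => ?_, mulVec_comp_iso φ ?_⟩
  · have := congrFun h (φ.symm (Sum.inl ⟨0, hβ⟩))
    simp at this
  · rintro (a | b)
    · simp only [Fintype.sum_sum_type, graphJoin_adj_inl_inl, SimpleGraph.top_adj,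
        graphJoin_adj_inl_inr, Sum.elim_inl, Sum.elim_inr, if_true, sum_ite_ne_eq]
      simp
      linarith
    · simp only [Fintype.sum_sum_type, graphJoin_adj_inr_inr, SimpleGraph.bot_adj,
        (graphJoin_adj_inl_inr _ _ _ _).symm, Sum.elim_inl, Sum.elim_inr, if_true, if_false]
      simp
      ring

theorem exists_eigenvector_of_iso_graphSum {V : Type*} [Fintype V] {G : SimpleGraph V} {β m : ℕ}
    (φ : G ≃g graphSum (⊤ : SimpleGraph (Fin (2 * β + 1))) (⊥ : SimpleGraph (Fin m))) :
    ∃ v : V → ℝ, v ≠ 0 ∧ (degMat G + adjMat G).mulVec v = (4 * β : ℝ) • v := by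
  refine ⟨Sum.elim (fun _ => 1) (fun _ => 0) ∘ φ, fun h => ?_, mulVec_comp_iso φ ?_⟩
  · have := congrFun h (φ.symm (Sum.inl 0))
    simp at this
  · rintro (a | b)
    · simp only [Fintype.sum_sum_type, graphSum_adj_inl_inl, SimpleGraph.top_adj,
        not_graphSum_adj_inl_inr, Sum.elim_inl, Sum.elim_inr, if_false, sum_ite_ne_eq]
      simp
      ring
    · simp [Fintype.sum_sum_type, graphSum_adj_inr_inr,
        SimpleGraph.adj_comm _ (Sum.inr b), not_graphSum_adj_inl_inr]

theorem specRad_mem_of_ne_zero {V : Type*} [Fintype V] {M : Matrix V V ℝ} (h : specRad M ≠ 0) :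
    ∃ v : V → ℝ, v ≠ 0 ∧ M.mulVec v = specRad M • v := by
  have hfin : {t : ℝ | ∃ v : V → ℝ, v ≠ 0 ∧ M.mulVec v = t • v}.Finite := by
    refine (Module.End.finite_hasEigenvalue (Matrix.toLin' M)).subset ?_
    rintro t ⟨v, hv, hMv⟩
    exact Module.End.hasEigenvalue_of_hasEigenvector
      ⟨Module.End.mem_eigenspace_iff.2 (by rw [Matrix.toLin'_apply]; exact hMv), hv⟩
  refine Set.Nonempty.csSup_mem ?_ hfin
  rw [Set.nonempty_iff_ne_empty]
  intro he
  rw [specRad, he, Real.sSup_empty] at h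
  exact h rfl

theorem stmt10 (n β : ℕ) (G : SimpleGraph (Fin n))
    (hβ : matchingNumber G = β) (h2 : (n : ℝ) = (5 * β + 3) / 2) :
    specRad (degMat G + adjMat G) ≤ 4 * β ∧
      (specRad (degMat G + adjMat G) = 4 * β ↔
        (Nonempty (G ≃g graphJoin (⊤ : SimpleGraph (Fin β))
            (⊥ : SimpleGraph (Fin (n - β)))) ∨
          Nonempty (G ≃g graphSum (⊤ : SimpleGraph (Fin (2 * β + 1)))
            (⊥ : SimpleGraph (Fin (n - (2 * β + 1))))))) := by
  have hn : (2 * n : ℝ) = 5 * β + 3 := by linarith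
  have hnN : 2 * n = 5 * β + 3 := by exact_mod_cast hn
  have hβ0 : (0 : ℝ) < β := by exact_mod_cast (by lia : 0 < β)
  obtain ⟨S, P, hSβ, hmem, hadj, hP, hcard, hsum⟩ :=
    exists_small_clusters G (d := n - 2 * β - 2) hβ (by rw [Fintype.card_fin]; lia)
  have key : ∀ t : ℝ, (∃ v : Fin n → ℝ, v ≠ 0 ∧ (degMat G + adjMat G).mulVec v = t • v) →
      t ≤ 4 * β ∧ (t = 4 * β → (Nonempty (G ≃g graphJoin (⊤ : SimpleGraph (Fin β))
            (⊥ : SimpleGraph (Fin (n - β)))) ∨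
          Nonempty (G ≃g graphSum (⊤ : SimpleGraph (Fin (2 * β + 1)))
            (⊥ : SimpleGraph (Fin (n - (2 * β + 1))))))) := by
    rintro t ⟨v, hv, hQ⟩
    rcases S.eq_empty_or_nonempty with rfl | hS
    · simp only [Finset.notMem_empty, not_false_eq_true, forall_true_left, Finset.card_empty,
        Nat.sub_zero, Finset.compl_empty] at hmem hadj hcard hsum
      obtain ⟨h3, h4⟩ := eigenvalue_le_of_clusters G hmem hadj hP hcard hsum hv hQ
      refine ⟨h3, fun ht => ?_⟩
      obtain ⟨U, hU, hG⟩ := h4 ht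
      exact Or.inr (nonempty_iso_graphSum hU (by rw [Fintype.card_fin]) hG)
    · obtain ⟨h3, h4⟩ := eigenvalue_le_of_barrier G (by rw [Fintype.card_fin]; exact hn) hS hSβ
        hmem hadj hP hcard hsum hv hQ
      refine ⟨h3, fun ht => ?_⟩
      obtain ⟨hSeq, hG⟩ := h4 ht
      exact Or.inl (nonempty_iso_graphJoin hSeq (by rw [Fintype.card_fin]) hG)
  have hle : specRad (degMat G + adjMat G) ≤ 4 * β :=
    Real.sSup_le (fun t ht => (key t ht).1) (by positivity)
  refine ⟨hle, fun h => ?_, fun h => le_antisymm hle ?_⟩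
  · obtain ⟨v, hv⟩ := specRad_mem_of_ne_zero (M := degMat G + adjMat G) (by rw [h]; positivity)
    exact (key _ ⟨v, hv⟩).2 h
  · refine le_csSup ⟨4 * β, fun t ht => (key t ht).1⟩ ?_
    rcases h with ⟨⟨φ⟩⟩ | ⟨⟨φ⟩⟩
    · refine exists_eigenvector_of_iso_graphJoin (by lia) ?_ φ
      rw [Nat.cast_sub (by lia)]
      linarith
    · exact exists_eigenvector_of_iso_graphSum φ
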